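/- Decomposition of the marginal entropy evolution in the linear Gaussian case. Let X = (X_1,…,X_d) be a real random vector with finite second moments such that the marginal law of X_1 is Gaussian with mean μ_1 and variance σ_{11} > 0, with density ρ_1(x) = (2πσ_{11})^{−1/2} exp(−(x−μ_1)²/(2σ_{11})). Let a_{11},…,a_{1d} be real constants and g_{11} ≥ 0 a constant. Then −E[(Σ_{j=1}^d a_{1j} X_j)·(log ρ_1)′(X_1)] − (1/2) g_{11} E[(log ρ_1)″(X_1)] = a_{11} + Σ_{j=2}^d a_{1j} σ_{1j}/σ_{11} + g_{11}/(2σ_{11}), where σ_{1j} = Cov(X_1, X_j). In particular, the marginal entropy rate of X_1 decomposes into the self-contribution a_{11}, the information flows T_{j→1} = a_{1j}σ_{1j}/σ_{11} from the other components, and the always-nonnegative noise contribution g_{11}/(2σ_{11}). -/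

import Mathlib

open MeasureTheory Real Finset

/-- **Decomposition of the marginal entropy evolution in the
linear Gaussian case.**
Let `X = (X_1,…,X_d)` (here `d + 1` components, indexed by `Fin (d+1)`, with
component 1 being index `0`) be a random vector with finite second moments whose
first component is Gaussian with mean `μ1`, variance `σ11 > 0`, and density
`ρ1`.  Then for constants `a_{1j}` and `g11 ≥ 0`,
`−E[(Σ_j a_{1j} X_j)(log ρ1)′(X_1)] − (1/2) g11 E[(log ρ1)″(X_1)]
  = a_{11} + Σ_{j≥2} a_{1j} σ_{1j}/σ_{11} + g_{11}/(2σ_{11})`,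
where `σ_{1j} = Cov(X_1, X_j)`. -/
theorem stmt_11 (d : ℕ) (Ω : Type*) [MeasureSpace Ω]
    [IsProbabilityMeasure (volume : Measure Ω)]
    (X : Ω → Fin (d + 1) → ℝ)
    (hXmeas : ∀ j, Measurable (fun ω => X ω j))
    -- finite second moments
    (hX2 : ∀ j, MemLp (fun ω => X ω j) 2 volume)
    -- the first component is Gaussian with mean μ1 and variance σ11 > 0
    (μ1 σ11 : ℝ) (hσ11 : 0 < σ11)
    (ρ1 : ℝ → ℝ)
    (hρ1 : ∀ x, ρ1 x = (2 * π * σ11) ^ (-(1 : ℝ) / 2)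
        * Real.exp (-(x - μ1) ^ 2 / (2 * σ11)))
    (hlaw : Measure.map (fun ω => X ω 0) volume
        = volume.withDensity (fun x => ENNReal.ofReal (ρ1 x)))
    -- constants
    (a : Fin (d + 1) → ℝ) (g11 : ℝ) (hg11 : 0 ≤ g11)
    -- the covariances σ_{1j} = Cov(X_1, X_j)
    (σ1 : Fin (d + 1) → ℝ)
    (hσ1 : ∀ j, σ1 j = ∫ ω, (X ω 0 - ∫ ω', X ω' 0) * (X ω j - ∫ ω', X ω' j)) :
    -(∫ ω, (∑ j, a j * X ω j) * deriv (fun x => Real.log (ρ1 x)) (X ω 0))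
      - (1 / 2) * g11 * (∫ ω, deriv (deriv (fun x => Real.log (ρ1 x))) (X ω 0))
    = a 0 + (∑ j ∈ Finset.univ.erase 0, a j * σ1 j / σ11) + g11 / (2 * σ11) := by
  have hlog : (fun x => Real.log (ρ1 x)) = fun x =>
      Real.log ((2 * π * σ11) ^ (-(1 : ℝ) / 2)) + -(x - μ1) ^ 2 / (2 * σ11) := by
    funext x
    have hc : (0 : ℝ) < (2 * π * σ11) ^ (-(1 : ℝ) / 2) := by positivity
    rw [hρ1, Real.log_mul hc.ne' (Real.exp_pos _).ne', Real.log_exp]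
  have hd1 : deriv (fun x => Real.log (ρ1 x)) = fun x => -(x - μ1) / σ11 := by
    funext x
    rw [hlog]
    have h1 : HasDerivAt (fun x : ℝ => Real.log ((2 * π * σ11) ^ (-(1 : ℝ) / 2))
        + -(x - μ1) ^ 2 / (2 * σ11)) (-(2 * (x - μ1)) / (2 * σ11)) x := by
      have h := (((((hasDerivAt_id x).sub_const μ1).pow 2).neg).div_const
        (2 * σ11)).const_add (Real.log ((2 * π * σ11) ^ (-(1 : ℝ) / 2)))
      have he : -(2 * (x - μ1)) / (2 * σ11)
          = -(((2 : ℕ) : ℝ) * (id x - μ1) ^ (2 - 1) * 1) / (2 * σ11) := by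
        simp
      rw [he]
      exact h
    rw [h1.deriv]
    field_simp
  have hd2 : deriv (deriv (fun x => Real.log (ρ1 x))) = fun _ => -1 / σ11 := by
    funext x
    rw [hd1]
    exact ((((hasDerivAt_id x).sub_const μ1).neg).div_const σ11).deriv
  obtain ⟨v, hv0⟩ : ∃ v : NNReal, (v : ℝ) = σ11 :=
    ⟨Real.toNNReal σ11, Real.coe_toNNReal _ hσ11.le⟩
  have hgauss : Measure.map (fun ω => X ω 0) volume
      = ProbabilityTheory.gaussianReal μ1 v := by
    rw [hlaw, ProbabilityTheory.gaussianReal_of_var_ne_zero]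
    · congr 1
      funext x
      rw [ProbabilityTheory.gaussianPDF, ProbabilityTheory.gaussianPDFReal, hρ1, hv0]
      congr 2
      rw [neg_div, Real.rpow_neg (by positivity), ← Real.sqrt_eq_rpow]
    · intro h
      rw [h] at hv0
      simp at hv0
      exact hσ11.ne hv0
  have hmean : ∫ ω, X ω 0 = μ1 := by
    have h := integral_map (μ := (volume : Measure Ω)) (hXmeas 0).aemeasurable
      (f := fun x : ℝ => x) (by fun_prop)
    rw [hgauss, ProbabilityTheory.integral_id_gaussianReal] at h
    exact h.symm
  have hvar : ∫ ω, (X ω 0 - μ1) * (X ω 0 - μ1) = σ11 := by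
    have h := integral_map (μ := (volume : Measure Ω)) (hXmeas 0).aemeasurable
      (f := fun x : ℝ => (x - μ1) * (x - μ1)) (by fun_prop)
    have hv := ProbabilityTheory.variance_fun_id_gaussianReal (μ := μ1) (v := v)
    rw [ProbabilityTheory.variance_eq_integral (by fun_prop),
      ProbabilityTheory.integral_id_gaussianReal, hv0] at hv
    rw [hgauss] at h
    rw [← h]
    simp only [← pow_two]
    exact hv
  have hc0 : MemLp (fun ω => X ω 0 - μ1) 2 volume := (hX2 0).sub (memLp_const μ1)
  have hint : ∀ j, Integrable (fun ω => (X ω 0 - μ1) * X ω j) volume :=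
    fun j => hc0.integrable_mul (hX2 j)
  have hi0 : Integrable (fun ω => X ω 0 - μ1) volume := hc0.integrable (by norm_num)
  have hz : ∫ ω, (X ω 0 - μ1) = 0 := by
    rw [integral_sub ((hX2 0).integrable (by norm_num)) (integrable_const _), hmean]
    simp
  have hcov : ∀ j, ∫ ω, (X ω 0 - μ1) * X ω j = σ1 j := by
    intro j
    rw [hσ1, hmean]
    simp only [mul_sub]
    rw [integral_sub (hint j) (hi0.mul_const _), integral_mul_const, hz]
    simp
  have h00 : σ1 0 = σ11 := by rw [hσ1, hmean, hvar]
  have hmain : ∫ ω, (∑ j, a j * X ω j) * (-(X ω 0 - μ1) / σ11)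
      = - ∑ j, a j * σ1 j / σ11 := by
    have : ∀ ω, (∑ j, a j * X ω j) * (-(X ω 0 - μ1) / σ11)
        = ∑ j, (-(a j / σ11)) * ((X ω 0 - μ1) * X ω j) := by
      intro ω
      rw [Finset.sum_mul]
      exact Finset.sum_congr rfl fun j _ => by ring
    simp only [this]
    rw [integral_finsetSum _ fun j _ => (hint j).const_mul _]
    simp only [integral_const_mul, hcov]
    rw [← Finset.sum_neg_distrib]
    exact Finset.sum_congr rfl fun j _ => by ring
  rw [hd2, hd1]
  simp only [hmain]
  rw [← Finset.add_sum_erase _ _ (Finset.mem_univ (0 : Fin (d + 1))), h00]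
  simp only [integral_const, probReal_univ, one_smul]
  field_simp
  ring
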